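/- Let k > 0, T > 0, let N ≥ 1 and n ≥ 0 be natural numbers, let θ₁ > 0, and let F : ℝ → ℂ be measurable with ∫_{-∞}^{∞} |F(ξ)|² dξ ≤ M². Then ∫_{|ξ| ≤ θ₁} (1 - e^{-kξ²T/N})^{2n} |F(ξ)|² dξ ≤ N^{2N} (n+1)^{-2N} e^{2kθ₁²T} M². -/

import Mathlib

open MeasureTheory Real
open scoped Real

/-- The residual factor `(1 - l) ^ n` is controlled by powers of the step `l ∈ [0, 1]`. -/
theorem one_sub_pow_mul_pow_le {l : ℝ} (h0 : 0 ≤ l) (h1 : l ≤ 1) {N : ℕ} (hN : 1 ≤ N) (n : ℕ) :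
    (1 - l) ^ n * l ^ N ≤ (N : ℝ) ^ N / ((n : ℝ) + 1) ^ N := by
  have hN' : (1 : ℝ) ≤ N := by exact_mod_cast hN
  have hNpos : (0 : ℝ) < N := by linarith
  set y : ℝ := ((n : ℝ) + 1) * l / N with hy
  have hy0 : 0 ≤ y := by positivity
  have hyN : y ^ N ≤ Real.exp (((n : ℝ) + 1) * l - N) := by
    have h : y ≤ Real.exp (y - 1) := by linarith [Real.add_one_le_exp (y - 1)]
    calc y ^ N ≤ Real.exp (y - 1) ^ N := pow_le_pow_left₀ hy0 h N
      _ = Real.exp (((n : ℝ) + 1) * l - N) := by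
        rw [← Real.exp_nat_mul, hy]
        congr 1
        field_simp
  have hln : (1 - l) ^ n ≤ Real.exp (-(n * l)) := by
    calc (1 - l) ^ n ≤ Real.exp (-l) ^ n :=
          pow_le_pow_left₀ (by linarith) (Real.one_sub_le_exp_neg l) n
      _ = Real.exp (-(n * l)) := by
        rw [← Real.exp_nat_mul]
        congr 1
        ring
  have hprod : (1 - l) ^ n * y ^ N ≤ 1 := by
    calc (1 - l) ^ n * y ^ N
        ≤ Real.exp (-(n * l)) * Real.exp (((n : ℝ) + 1) * l - N) :=
          mul_le_mul hln hyN (by positivity) (by positivity)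
      _ = Real.exp (l - N) := by
        rw [← Real.exp_add]
        congr 1
        ring
      _ ≤ 1 := Real.exp_le_one_iff.mpr (by linarith)
  have hl : l ^ N = y ^ N * ((N : ℝ) ^ N / ((n : ℝ) + 1) ^ N) := by
    rw [← div_pow, ← mul_pow, hy]
    congr 1
    field_simp
  rw [hl, ← mul_assoc]
  exact mul_le_of_le_one_left (by positivity) hprod

/-- Bound for the residual factor with step `exp (-a / N)`. -/
theorem one_sub_exp_pow_le {a : ℝ} (ha : 0 ≤ a) {N : ℕ} (hN : 1 ≤ N) (n : ℕ) :
    (1 - Real.exp (-a / N)) ^ n ≤ (N : ℝ) ^ N / ((n : ℝ) + 1) ^ N * Real.exp a := by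
  have hNpos : (0 : ℝ) < N := by exact_mod_cast hN
  have hle : Real.exp (-a / N) ≤ 1 :=
    Real.exp_le_one_iff.mpr (div_nonpos_of_nonpos_of_nonneg (by linarith) hNpos.le)
  have hpow : Real.exp (-a / N) ^ N = Real.exp (-a) := by
    rw [← Real.exp_nat_mul, mul_div_cancel₀ _ hNpos.ne']
  have h := one_sub_pow_mul_pow_le (Real.exp_pos _).le hle hN n
  rw [hpow, Real.exp_neg, ← div_eq_mul_inv] at h
  exact (div_le_iff₀ (Real.exp_pos a)).mp h

/-- Low-frequency approximation-error bound for the iteration with step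
`λ(ξ) = e^{-kξ²T/N}`: if `∫ |F(ξ)|² dξ ≤ M²`, then
`∫_{|ξ|≤θ₁} (1 - e^{-kξ²T/N})^{2n} |F(ξ)|² dξ ≤ N^{2N} (n+1)^{-2N} e^{2kθ₁²T} M²`. -/
theorem lowfreq_residual_bound (k T θ₁ M : ℝ) (hk : 0 < k) (hT : 0 < T) (hθ : 0 < θ₁)
    (N : ℕ) (hN : 1 ≤ N) (n : ℕ) (F : ℝ → ℂ) (hmeas : Measurable F)
    (hint : Integrable (fun ξ : ℝ => ‖F ξ‖ ^ 2))
    (hbound : ∫ ξ : ℝ, ‖F ξ‖ ^ 2 ≤ M ^ 2) :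
    ∫ ξ in Set.Icc (-θ₁) θ₁,
      (1 - Real.exp (-(k * ξ ^ 2 * T) / (N : ℝ))) ^ (2 * n) * ‖F ξ‖ ^ 2 ≤
      (N : ℝ) ^ (2 * N) / ((n : ℝ) + 1) ^ (2 * N) * Real.exp (2 * k * θ₁ ^ 2 * T) * M ^ 2 := by
  set C : ℝ := (N : ℝ) ^ (2 * N) / ((n : ℝ) + 1) ^ (2 * N) * Real.exp (2 * k * θ₁ ^ 2 * T) with hC
  have hC0 : 0 ≤ C := by positivity
  have hfactor : ∀ ξ ∈ Set.Icc (-θ₁) θ₁,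
      (1 - Real.exp (-(k * ξ ^ 2 * T) / (N : ℝ))) ^ (2 * n) ≤ C := by
    intro ξ hξ
    have hsq : ξ ^ 2 ≤ θ₁ ^ 2 := sq_le_sq' hξ.1 hξ.2
    have ha : 0 ≤ k * ξ ^ 2 * T := by positivity
    have hle : Real.exp (-(k * ξ ^ 2 * T) / N) ≤ 1 :=
      Real.exp_le_one_iff.mpr
        (div_nonpos_of_nonpos_of_nonneg (by linarith) (Nat.cast_nonneg N))
    have hres : (1 - Real.exp (-(k * ξ ^ 2 * T) / (N : ℝ))) ^ n ≤
        (N : ℝ) ^ N / ((n : ℝ) + 1) ^ N * Real.exp (k * θ₁ ^ 2 * T) :=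
      (one_sub_exp_pow_le ha hN n).trans (by gcongr)
    calc (1 - Real.exp (-(k * ξ ^ 2 * T) / (N : ℝ))) ^ (2 * n)
        = ((1 - Real.exp (-(k * ξ ^ 2 * T) / (N : ℝ))) ^ n) ^ 2 := pow_mul' _ 2 n
      _ ≤ ((N : ℝ) ^ N / ((n : ℝ) + 1) ^ N * Real.exp (k * θ₁ ^ 2 * T)) ^ 2 :=
        pow_le_pow_left₀ (pow_nonneg (by linarith) n) hres 2
      _ = C := by
        rw [hC, mul_pow, div_pow, ← pow_mul, ← pow_mul, mul_comm N 2, ← Real.exp_nat_mul]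
        congr 2
        push_cast
        ring
  have hnonneg : ∀ ξ : ℝ, 0 ≤
      (1 - Real.exp (-(k * ξ ^ 2 * T) / (N : ℝ))) ^ (2 * n) * ‖F ξ‖ ^ 2 := fun ξ =>
    mul_nonneg ((even_two_mul n).pow_nonneg _) (by positivity)
  calc ∫ ξ in Set.Icc (-θ₁) θ₁,
        (1 - Real.exp (-(k * ξ ^ 2 * T) / (N : ℝ))) ^ (2 * n) * ‖F ξ‖ ^ 2
      ≤ ∫ ξ in Set.Icc (-θ₁) θ₁, C * ‖F ξ‖ ^ 2 := by
        refine integral_mono_of_nonneg (.of_forall hnonneg) (hint.const_mul C).integrableOn ?_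
        filter_upwards [ae_restrict_mem measurableSet_Icc] with ξ hξ
        exact mul_le_mul_of_nonneg_right (hfactor ξ hξ) (by positivity)
    _ ≤ ∫ ξ : ℝ, C * ‖F ξ‖ ^ 2 :=
        setIntegral_le_integral (hint.const_mul C) (.of_forall fun ξ => by positivity)
    _ = C * ∫ ξ : ℝ, ‖F ξ‖ ^ 2 := integral_const_mul _ _
    _ ≤ C * M ^ 2 := mul_le_mul_of_nonneg_left hbound hC0
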